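/- Let S be a tightly connected, fundamental, completely semisimple inverse semigroup with no isolated nontrivial subgroups, let T be an inverse semigroup, and let Ψ be a lattice isomorphism of S onto T whose associated E-bijection ψ_E is a semilattice isomorphism of E_S onto E_T. Then there exists a unique isomorphism φ of S onto T inducing Ψ, i.e. such that HΨ equals the image of H under φ for every inverse subsemigroup H of S. -/

import Mathlib

/-- An inverse semigroup: a semigroup in which every element `a` has a unique
element `a⁻¹` with `a * a⁻¹ * a = a` and `a⁻¹ * a * a⁻¹ = a⁻¹`. -/
class InverseSemigroup (S : Type*) extends Semigroup S, Inv S where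
  mul_inv_mul : ∀ a : S, a * a⁻¹ * a = a
  inv_mul_inv : ∀ a : S, a⁻¹ * a * a⁻¹ = a⁻¹
  inv_unique : ∀ a b : S, a * b * a = a → b * a * b = b → b = a⁻¹

section InvSgDefs

variable (S : Type*) [InverseSemigroup S]

/-- The set of idempotents of `S`. -/
def ES : Set S := {e : S | IsIdempotentElem e}

/-- The set of nongroup elements of `S`. -/
def NS : Set S := {x : S | x * x⁻¹ ≠ x⁻¹ * x}

/-- `N_S ∪ E_S`. -/
def NE : Set S := NS S ∪ ES S

variable {S}

/-- The order on idempotents: `e ≤ f` iff `e * f = e`. -/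
def idemLe (e f : S) : Prop := e * f = e

/-- Strict order on idempotents. -/
def idemLt (e f : S) : Prop := idemLe e f ∧ e ≠ f

/-- The natural partial order on an inverse semigroup: `a ≤ b` iff `a = e * b`
for some idempotent `e`. -/
def natLe (a b : S) : Prop := ∃ e : S, IsIdempotentElem e ∧ a = e * b

/-- Green's relation `𝓡`. -/
def rRel (a b : S) : Prop := a * a⁻¹ = b * b⁻¹

/-- Green's relation `𝓛`. -/
def lRel (a b : S) : Prop := a⁻¹ * a = b⁻¹ * b

/-- Green's relation `𝓗`. -/
def hRel (a b : S) : Prop := rRel a b ∧ lRel a b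

/-- Green's relation `𝓓`. -/
def dRel (a b : S) : Prop := ∃ c : S, rRel a c ∧ lRel c b

/-- `U` is an inverse subsemigroup of `S`: closed under multiplication and inversion. -/
def IsInvSub (U : Set S) : Prop :=
  (∀ a ∈ U, ∀ b ∈ U, a * b ∈ U) ∧ ∀ a ∈ U, a⁻¹ ∈ U

/-- The inverse subsemigroup generated by `X`: the smallest subset of `S`
containing `X` and closed under multiplication and inversion. -/
def genInv (X : Set S) : Set S := ⋂₀ {U : Set S | IsInvSub U ∧ X ⊆ U}

/-- `e` is `x`-covered by `x * x⁻¹`: `e < x * x⁻¹` and no idempotent `f` of `⟨x⟩`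
satisfies `e < f < x * x⁻¹`. -/
def XCov (x e : S) : Prop :=
  idemLt e (x * x⁻¹) ∧
    ∀ f ∈ genInv ({x} : Set S), IsIdempotentElem f →
      ¬(idemLt e f ∧ idemLt f (x * x⁻¹))

/-- `e` is tightly `x`-covered by `x * x⁻¹`. -/
def TightXCov (x e : S) : Prop :=
  XCov x e ∧ (e * x ∈ NS S ∨ IsIdempotentElem (e * x))

/-- A short bypass from `e` to `x * x⁻¹`. -/
def ShortBypass (x e : S) : Prop :=
  ∃ n : ℕ, 1 ≤ n ∧ ∃ es : ℕ → S,
    es 0 = e ∧ es n = x * x⁻¹ ∧ (∀ k ≤ n, IsIdempotentElem (es k)) ∧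
    ∀ k : ℕ, 1 ≤ k → k ≤ n → idemLt (es (k - 1)) (es k) ∧ XCov (es k * x) (es (k - 1))

/-- A tight bypass from `e` to `x * x⁻¹`. -/
def TightBypass (x e : S) : Prop :=
  ∃ n : ℕ, 1 ≤ n ∧ ∃ es : ℕ → S,
    es 0 = e ∧ es n = x * x⁻¹ ∧ (∀ k ≤ n, IsIdempotentElem (es k)) ∧
    ∀ k : ℕ, 1 ≤ k → k ≤ n → idemLt (es (k - 1)) (es k) ∧ TightXCov (es k * x) (es (k - 1))

variable (S)

/-- `S` is shortly connected. -/
def ShortlyConnected : Prop :=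
  ∀ x : S, ∀ e : S, IsIdempotentElem e → idemLt e (x * x⁻¹) → ShortBypass x e

/-- `S` is tightly connected. -/
def TightlyConnected : Prop :=
  ∀ x ∈ NE S, ∀ e : S, IsIdempotentElem e → idemLt e (x * x⁻¹) → TightBypass x e

/-- `S` is fundamental. -/
def Fundamental : Prop :=
  ∀ x y : S, (∀ e : S, IsIdempotentElem e → x⁻¹ * e * x = y⁻¹ * e * y) → x = y

/-- `S` is combinatorial. -/
def Combinatorial : Prop :=
  ∀ a b : S, a * a⁻¹ = b * b⁻¹ → a⁻¹ * a = b⁻¹ * b → a = b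

/-- `S` has no isolated nontrivial subgroups: for every idempotent `e` whose
`𝓗`-class is nontrivial there is an idempotent `f ≠ e` with `e 𝓓 f`. -/
def NoIsolatedNontrivial : Prop :=
  ∀ e : S, IsIdempotentElem e → (∃ h : S, h ≠ e ∧ hRel h e) →
    ∃ f : S, IsIdempotentElem f ∧ f ≠ e ∧ dRel e f

/-- `S` is completely semisimple. -/
def CompletelySemisimple : Prop :=
  ∀ e f : S, IsIdempotentElem e → IsIdempotentElem f → idemLe e f → dRel e f → e = f

end InvSgDefs

namespace IS

section Basic

variable {S : Type*} [InverseSemigroup S]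

theorem mim (a : S) : a * (a⁻¹ * a) = a := by
  rw [← mul_assoc]; exact InverseSemigroup.mul_inv_mul a

theorem imi (a : S) : a⁻¹ * (a * a⁻¹) = a⁻¹ := by
  rw [← mul_assoc]; exact InverseSemigroup.inv_mul_inv a

theorem mim' (a b : S) : a * (a⁻¹ * (a * b)) = a * b := by
  rw [← mul_assoc a⁻¹, ← mul_assoc, mim]

theorem imi' (a b : S) : a⁻¹ * (a * (a⁻¹ * b)) = a⁻¹ * b := by
  rw [← mul_assoc a, ← mul_assoc, imi]

theorem inv_inv' (a : S) : a⁻¹⁻¹ = a :=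
  (InverseSemigroup.inv_unique a⁻¹ a (InverseSemigroup.inv_mul_inv a)
    (InverseSemigroup.mul_inv_mul a)).symm

theorem idem_inv {e : S} (he : IsIdempotentElem e) : e⁻¹ = e := by
  have h : e * e = e := he
  exact (InverseSemigroup.inv_unique e e (by rw [h, h]) (by rw [h, h])).symm

theorem idem_mul {e f : S} (he : IsIdempotentElem e) (hf : IsIdempotentElem f) :
    IsIdempotentElem (e * f) := by
  have h1 : e * e = e := he
  have h2 : f * f = f := hf
  have h1' : ∀ z, e * (e * z) = e * z := fun z => by rw [← mul_assoc, h1]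
  have h2' : ∀ z, f * (f * z) = f * z := fun z => by rw [← mul_assoc, h2]
  set x := (e * f)⁻¹ with hx
  have a1 : (e * f) * (x * (e * f)) = e * f := mim (e * f)
  have a2 : x * ((e * f) * x) = x := imi (e * f)
  have a3 : f * (x * e) = x := by
    apply InverseSemigroup.inv_unique
    · simp only [mul_assoc, h1', h2'] at a1 ⊢
      exact a1
    · simp only [mul_assoc, h1', h2'] at a2 ⊢
      have : x * (e * (f * (x * e))) = x * e := by
        conv_rhs => rw [← a2]
        simp only [mul_assoc]
      rw [this]
  have a4 : x * x = x := by
    have t1 : x * (e * (f * (x * e))) = x * e := by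
      conv_rhs => rw [← a2]
      simp only [mul_assoc]
    have t2 : f * (x * e) * (f * (x * e)) = x := by
      simp only [mul_assoc, t1]
      exact a3
    rwa [a3] at t2
  have a5 : x⁻¹ = x := idem_inv a4
  have a6 : e * f = x := by rw [← a5, hx, inv_inv']
  show e * f * (e * f) = e * f
  rw [a6, a4]

theorem idem_comm {e f : S} (he : IsIdempotentElem e) (hf : IsIdempotentElem f) :
    e * f = f * e := by
  have h1 : e * e = e := he
  have h2 : f * f = f := hf
  have h1' : ∀ z, e * (e * z) = e * z := fun z => by rw [← mul_assoc, h1]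
  have h2' : ∀ z, f * (f * z) = f * z := fun z => by rw [← mul_assoc, h2]
  have h3 : e * f * (e * f) = e * f := idem_mul he hf
  have h4 : f * e * (f * e) = f * e := idem_mul hf he
  have : f * e = (e * f)⁻¹ := by
    apply InverseSemigroup.inv_unique
    · simp only [mul_assoc, h1', h2'] at h3 ⊢
      exact h3
    · simp only [mul_assoc, h1', h2'] at h4 ⊢
      exact h4
  rw [this, idem_inv (idem_mul he hf)]

/-- domain idempotent -/
def dm (x : S) : S := x * x⁻¹

/-- range idempotent -/
def rg (x : S) : S := x⁻¹ * x

theorem dm_idem (x : S) : IsIdempotentElem (dm x) := by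
  show x * x⁻¹ * (x * x⁻¹) = x * x⁻¹
  rw [mul_assoc, imi]

theorem rg_idem (x : S) : IsIdempotentElem (rg x) := by
  show x⁻¹ * x * (x⁻¹ * x) = x⁻¹ * x
  rw [mul_assoc, mim]

theorem dm_inv (x : S) : dm x⁻¹ = rg x := by rw [dm, rg, inv_inv']

theorem rg_inv (x : S) : rg x⁻¹ = dm x := by rw [dm, rg, inv_inv']

theorem dm_mul_self (x : S) : dm x * x = x := by rw [dm, mul_assoc, mim]

theorem mul_rg_self (x : S) : x * rg x = x := by rw [rg, mim]

theorem inv_mul' (a b : S) : (a * b)⁻¹ = b⁻¹ * a⁻¹ := by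
  have h : dm b * rg a = rg a * dm b := idem_comm (dm_idem b) (rg_idem a)
  symm
  apply InverseSemigroup.inv_unique
  · have : a * b * (b⁻¹ * a⁻¹) * (a * b) = a * (dm b * rg a) * b := by
      simp only [dm, rg, mul_assoc]
    rw [this, h]
    simp only [dm, rg, mul_assoc, mim, mim']
  · have : b⁻¹ * a⁻¹ * (a * b) * (b⁻¹ * a⁻¹) = b⁻¹ * (rg a * dm b) * a⁻¹ := by
      simp only [dm, rg, mul_assoc]
    rw [this, ← h]
    simp only [dm, rg, mul_assoc, imi, imi']

theorem idem_mul_self {e : S} (he : IsIdempotentElem e) : e * e = e := he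

theorem dm_of_idem {e : S} (he : IsIdempotentElem e) : dm e = e := by
  rw [dm, idem_inv he]; exact he

theorem rg_of_idem {e : S} (he : IsIdempotentElem e) : rg e = e := by
  rw [rg, idem_inv he]; exact he

theorem conj_eq {e : S} (he : IsIdempotentElem e) (x : S) :
    x⁻¹ * e * x = rg (e * x) := by
  rw [rg, inv_mul', idem_inv he]
  have : e * e = e := he
  simp only [mul_assoc]
  rw [← mul_assoc e e, this]

theorem conj_idem {e : S} (he : IsIdempotentElem e) (x : S) :
    IsIdempotentElem (x⁻¹ * e * x) := by
  rw [conj_eq he]; exact rg_idem _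

theorem dm_idem_mul {g : S} (hg : IsIdempotentElem g) (w : S) : dm (g * w) = g * dm w := by
  have h : g * dm w = dm w * g := idem_comm hg (dm_idem w)
  have h2 : g * g = g := hg
  have : dm (g * w) = g * (dm w * g) := by
    rw [dm, inv_mul', idem_inv hg, dm]; simp only [mul_assoc]
  rw [this, ← h, ← mul_assoc, h2]

theorem le_trans' {e f g : S} (h1 : e * f = e) (h2 : f * g = f) : e * g = e := by
  rw [← h1, mul_assoc, h2]

theorem le_antisymm' {e f : S} (he : IsIdempotentElem e) (hf : IsIdempotentElem f)
    (h1 : e * f = e) (h2 : f * e = f) : e = f := by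
  rw [← h1, idem_comm he hf, h2]

theorem le_mul' {e f g : S} (h1 : e * f = e) (h2 : e * g = e) : e * (f * g) = e := by
  rw [← mul_assoc, h1, h2]

theorem mul_le_right {e f : S} (hf : IsIdempotentElem f) : (e * f) * f = e * f := by
  have : f * f = f := hf
  rw [mul_assoc, this]

theorem mul_le_left {e f : S} (he : IsIdempotentElem e) (hf : IsIdempotentElem f) :
    (e * f) * e = e * f := by
  rw [idem_comm he hf]; exact mul_le_right he

theorem dm_mul_le (a b : S) : dm (a * b) * dm a = dm (a * b) := by
  rw [idem_comm (dm_idem _) (dm_idem _)]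
  simp only [dm, mul_assoc, mim']

theorem rg_mul_le (a b : S) : rg (a * b) * rg b = rg (a * b) := by
  simp only [rg, mul_assoc, mim]

theorem dm_mul_eq_iff (a b : S) : dm (a * b) = dm a ↔ rg a * dm b = rg a := by
  constructor
  · intro h
    have h1 : a⁻¹ * dm (a * b) * a = rg a * dm b * rg a := by
      simp only [dm, rg, inv_mul', mul_assoc]
    rw [h, mul_le_left (rg_idem a) (dm_idem b)] at h1
    rw [← h1]
    simp only [dm, rg, mul_assoc, mim]
  · intro h
    have h1 : dm (a * b) = a * (rg a * dm b) * a⁻¹ := by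
      simp only [dm, rg, inv_mul', mul_assoc, mim']
    rw [h1, h]
    simp only [dm, rg, mim]

theorem mul_of_rg_le {a e : S} (h : rg a * e = rg a) : a * e = a := by
  conv_lhs => rw [← mul_rg_self a, mul_assoc, h, mul_rg_self]

theorem mul_of_le_dm {a e : S} (he : IsIdempotentElem e) (h : dm a * e = dm a) : e * a = a := by
  rw [idem_comm (dm_idem a) he] at h
  conv_lhs => rw [← dm_mul_self a, ← mul_assoc, h, dm_mul_self]

/-! generated subsemigroups -/

theorem gen_sub (X : Set S) : IsInvSub (genInv X) := by
  refine ⟨fun a ha b hb => ?_, fun a ha => ?_⟩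
  · intro U hU
    exact hU.1.1 a (ha U hU) b (hb U hU)
  · intro U hU
    exact hU.1.2 a (ha U hU)

theorem subset_gen (X : Set S) : X ⊆ genInv X := fun _ hx _ hU => hU.2 hx

theorem gen_le {X U : Set S} (hU : IsInvSub U) (h : X ⊆ U) : genInv X ⊆ U :=
  fun _ ha => ha U ⟨hU, h⟩

theorem mem_gen (x : S) : x ∈ genInv ({x} : Set S) := subset_gen _ rfl

theorem gen1_le {x : S} {U : Set S} (hU : IsInvSub U) (h : x ∈ U) : genInv {x} ⊆ U :=
  gen_le hU (by simpa using h)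

theorem sing_sub {e : S} (he : IsIdempotentElem e) : IsInvSub ({e} : Set S) := by
  refine ⟨?_, ?_⟩
  · rintro a rfl b rfl; exact he
  · rintro a rfl; exact idem_inv he

theorem gen_idem {e : S} (he : IsIdempotentElem e) : genInv ({e} : Set S) = {e} :=
  Set.Subset.antisymm (gen_le (sing_sub he) (le_refl _)) (subset_gen _)

theorem gen_inv (x : S) : genInv ({x⁻¹} : Set S) = genInv {x} := by
  apply Set.Subset.antisymm
  · exact gen1_le (gen_sub _) ((gen_sub _).2 _ (mem_gen x))
  · apply gen1_le (gen_sub _)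
    have := (gen_sub {x⁻¹}).2 _ (mem_gen x⁻¹)
    rwa [inv_inv'] at this

theorem sub_dm {U : Set S} (hU : IsInvSub U) {x : S} (h : x ∈ U) : dm x ∈ U :=
  hU.1 _ h _ (hU.2 _ h)

theorem sub_rg {U : Set S} (hU : IsInvSub U) {x : S} (h : x ∈ U) : rg x ∈ U :=
  hU.1 _ (hU.2 _ h) _ h

/-- right-multiplication induction on generated inverse subsemigroups -/
theorem gen_act {X : Set S} {P : S → Prop}
    (h : ∀ x ∈ X, ∀ a, P a → P (a * x)) (h' : ∀ x ∈ X, ∀ a, P a → P (a * x⁻¹))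
    {w : S} (hw : w ∈ genInv X) : ∀ a, P a → P (a * w) := by
  have : IsInvSub {w : S | (∀ a, P a → P (a * w)) ∧ (∀ a, P a → P (a * w⁻¹))} := by
    refine ⟨?_, ?_⟩
    · rintro u ⟨hu, hu'⟩ v ⟨hv, hv'⟩
      refine ⟨fun a ha => ?_, fun a ha => ?_⟩
      · rw [← mul_assoc]; exact hv _ (hu _ ha)
      · rw [inv_mul', ← mul_assoc]; exact hu' _ (hv' _ ha)
    · rintro u ⟨hu, hu'⟩
      exact ⟨hu', by rwa [inv_inv']⟩
  exact (gen_le this (fun x hx => ⟨h x hx, h' x hx⟩) hw).1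

/-- walk lemma -/
theorem walk {X A : Set S} {e : S} (he : IsIdempotentElem e) (heA : e ∈ A)
    (h : ∀ x ∈ X, ∀ a ∈ A, dm a = e → dm (a * x) = e → a * x ∈ A)
    (h' : ∀ x ∈ X, ∀ a ∈ A, dm a = e → dm (a * x⁻¹) = e → a * x⁻¹ ∈ A)
    {w : S} (hw : w ∈ genInv X) (hwe : dm w = e) : w ∈ A := by
  have key : ∀ a, ((a ∈ A ∧ dm a = e) ∨ (dm a * e = dm a ∧ dm a ≠ e)) → ∀ x,
      (dm a = e → dm (a * x) = e → a ∈ A → a * x ∈ A) →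
      ((a * x ∈ A ∧ dm (a * x) = e) ∨ (dm (a * x) * e = dm (a * x) ∧ dm (a * x) ≠ e)) := by
    intro a ha x hx
    have hle : dm (a * x) * e = dm (a * x) := by
      rcases ha with ⟨_, h2⟩ | ⟨h1, _⟩
      · rw [← h2]; exact dm_mul_le a x
      · exact le_trans' (dm_mul_le a x) h1
    by_cases hd : dm (a * x) = e
    · rcases ha with ⟨h1, h2⟩ | ⟨h1, h2⟩
      · exact Or.inl ⟨hx h2 hd h1, hd⟩
      · exfalso
        apply h2
        apply le_antisymm' (dm_idem a) he h1
        rw [← hd]; exact dm_mul_le a x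
    · exact Or.inr ⟨hle, hd⟩
  have := gen_act (X := X)
    (P := fun a => (a ∈ A ∧ dm a = e) ∨ (dm a * e = dm a ∧ dm a ≠ e))
    (fun x hx a ha => key a ha x (fun h1 h2 h3 => h x hx a h3 h1 h2))
    (fun x hx a ha => key a ha x⁻¹ (fun h1 h2 h3 => h' x hx a h3 h1 h2))
    hw e (Or.inl ⟨heA, dm_of_idem he⟩)
  have hew : e * w = w := by rw [← hwe]; exact dm_mul_self w
  rw [hew] at this
  rcases this with h | h
  · exact h.1
  · exact absurd hwe h.2

theorem gen_mono_cases {y w : S} (hw : w ∈ genInv ({y} : Set S)) :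
    dm w * rg y = dm w ∨ dm w * dm (y * y) = dm w ∨ w = dm y ∨ w = y := by
  set P : S → Prop := fun w =>
    dm w * rg y = dm w ∨ dm w * dm (y * y) = dm w ∨ w = dm y ∨ w = y with hP
  have h1 : ∀ a x, (dm a * rg y = dm a ∨ dm a * dm (y * y) = dm a) → P (a * x) := by
    rintro a x (h | h)
    · exact Or.inl (le_trans' (dm_mul_le a x) h)
    · exact Or.inr (Or.inl (le_trans' (dm_mul_le a x) h))
  have hy : ∀ a, P a → P (a * y) := by
    rintro a (h | h | h | h)
    · exact h1 a y (Or.inl h)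
    · exact h1 a y (Or.inr h)
    · rw [h, dm_mul_self]; exact Or.inr (Or.inr (Or.inr rfl))
    · rw [h]; exact Or.inr (Or.inl (dm_idem _))
  have hy' : ∀ a, P a → P (a * y⁻¹) := by
    rintro a (h | h | h | h)
    · exact h1 a y⁻¹ (Or.inl h)
    · exact h1 a y⁻¹ (Or.inr h)
    · rw [h]; left
      rw [dm_idem_mul (dm_idem y), dm_inv]; exact mul_le_right (rg_idem y)
    · rw [h]; exact Or.inr (Or.inr (Or.inl rfl))
  -- all elements of the generated semigroup are below dm y or rg y
  have hle : dm w * dm y = dm w ∨ dm w * rg y = dm w := by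
    have hsub : IsInvSub {w : S | (dm w * dm y = dm w ∨ dm w * rg y = dm w) ∧
        (rg w * dm y = rg w ∨ rg w * rg y = rg w)} := by
      refine ⟨?_, ?_⟩
      · rintro u ⟨hu, _⟩ v ⟨_, hv⟩
        exact ⟨hu.imp (le_trans' (dm_mul_le u v)) (le_trans' (dm_mul_le u v)),
          hv.imp (le_trans' (rg_mul_le u v)) (le_trans' (rg_mul_le u v))⟩
      · rintro u ⟨hu, hv⟩
        refine ⟨?_, ?_⟩
        · rw [dm_inv]; exact hv
        · rw [rg_inv]; exact hu
    exact (gen1_le hsub ⟨Or.inl (dm_idem y), Or.inr (rg_idem y)⟩ hw).1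
  rcases hle with h | h
  · have := gen_act (X := {y}) (P := P) (by rintro x rfl; exact hy) (by rintro x rfl; exact hy')
      hw (dm y) (Or.inr (Or.inr (Or.inl rfl)))
    rwa [mul_of_le_dm (dm_idem y) h] at this
  · exact Or.inl h

theorem gen_le_cases {y w : S} (hw : w ∈ genInv ({y} : Set S)) :
    dm w * dm y = dm w ∨ dm w * rg y = dm w := by
  rcases gen_mono_cases hw with h | h | h | h
  · exact Or.inr h
  · exact Or.inl (le_trans' h (dm_mul_le y y))
  · rw [h]; exact Or.inl (by rw [dm_of_idem (dm_idem y)]; exact dm_idem y)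
  · rw [h]; exact Or.inl (dm_idem y)

/-- completely semisimple, in the form used -/
def CSS (S : Type*) [InverseSemigroup S] : Prop := ∀ a : S, rg a * dm a = rg a → rg a = dm a

theorem css_of (h : CompletelySemisimple S) : CSS S := by
  intro a ha
  apply h _ _ (rg_idem a) (dm_idem a) ha
  refine ⟨a⁻¹, ?_, ?_⟩
  · show dm (rg a) = dm a⁻¹
    rw [dm_inv, dm_of_idem (rg_idem a)]
  · show rg a⁻¹ = rg (dm a)
    rw [rg_inv, rg_of_idem (dm_idem a)]

theorem CSS.symm (h : CSS S) {a : S} (ha : dm a * rg a = dm a) : rg a = dm a := by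
  have := h a⁻¹ (by rw [dm_inv, rg_inv]; exact ha)
  rw [dm_inv, rg_inv] at this
  exact this.symm

theorem dm_sq_ne (hS : CSS S) {x : S} (hx : dm x ≠ rg x) : dm (x * x) ≠ dm x := by
  rw [Ne, dm_mul_eq_iff]
  intro h
  exact hx (hS x h).symm

theorem pq_ne (hS : CSS S) {x : S} (hx : dm x ≠ rg x) : dm x * rg x ≠ dm x := by
  intro h
  exact hx (hS.symm h).symm

/-- degenerate case equivalences -/
theorem deg_a (hS : CSS S) {y : S} (h : dm (y * y) * rg y = dm (y * y)) :
    dm (y * y) = dm y * rg y := by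
  have h1 : dm (y * y * y⁻¹) = dm (y * y) := by
    rw [dm_mul_eq_iff, dm_inv]; exact rg_mul_le y y
  have h2 : rg (y * y * y⁻¹) = dm y * rg y := by
    have : rg (y * y * y⁻¹) = dm y * rg y * dm y := by
      simp only [rg, dm, inv_mul', inv_inv', mul_assoc]
    rw [this, mul_le_left (dm_idem y) (rg_idem y)]
  rw [← h2, ← h1]
  symm
  apply hS.symm
  rw [h1, h2]
  exact le_mul' (dm_mul_le y y) h

theorem deg_b (hS : CSS S) {y : S} (h : dm y * rg y * dm (y * y) = dm y * rg y) :
    dm (y * y) = dm y * rg y := by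
  have h1 : dm (y * y * y⁻¹) = dm (y * y) := by
    rw [dm_mul_eq_iff, dm_inv]; exact rg_mul_le y y
  have h2 : rg (y * y * y⁻¹) = dm y * rg y := by
    have : rg (y * y * y⁻¹) = dm y * rg y * dm y := by
      simp only [rg, dm, inv_mul', inv_inv', mul_assoc]
    rw [this, mul_le_left (dm_idem y) (rg_idem y)]
  rw [← h2, ← h1]
  symm
  apply hS
  rw [h1, h2]
  exact h

theorem deg_inv {y : S} (h : dm (y * y) = dm y * rg y) : rg (y * y) = dm y * rg y := by
  have h1 : y⁻¹ * dm (y * y) * y = rg y * dm y * rg y := by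
    simp only [dm, rg, inv_mul', mul_assoc]
  have h2 : y⁻¹ * (dm y * rg y) * y = rg (y * y) := by
    simp only [dm, rg, inv_mul', mul_assoc, imi']
  rw [← h, h1, mul_le_left (rg_idem y) (dm_idem y), idem_comm (rg_idem y) (dm_idem y)] at h2
  exact h2.symm

theorem deg_inv' {y : S} (h : rg (y * y) = dm y * rg y) : dm (y * y) = dm y * rg y := by
  have := deg_inv (y := y⁻¹) (by
    rw [← inv_mul', dm_inv, dm_inv, rg_inv, h, idem_comm (dm_idem y) (rg_idem y)])
  rw [← inv_mul', rg_inv, dm_inv, rg_inv, idem_comm (rg_idem y) (dm_idem y)] at this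
  exact this

theorem deg_c (hS : CSS S) {y : S} (h : rg (y * y) * dm y = rg (y * y)) :
    dm (y * y) = dm y * rg y := by
  apply deg_inv'
  have := deg_a hS (y := y⁻¹) (by rw [← inv_mul', dm_inv, rg_inv]; exact h)
  rwa [← inv_mul', dm_inv, dm_inv, rg_inv, idem_comm (rg_idem y) (dm_idem y)] at this

theorem deg_d (hS : CSS S) {y : S} (h : dm y * rg y * rg (y * y) = dm y * rg y) :
    dm (y * y) = dm y * rg y := by
  apply deg_inv'
  have := deg_b hS (y := y⁻¹) (by
    rw [← inv_mul', dm_inv, dm_inv, rg_inv, idem_comm (rg_idem y) (dm_idem y)]; exact h)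
  rwa [← inv_mul', dm_inv, dm_inv, rg_inv, idem_comm (rg_idem y) (dm_idem y)] at this

theorem gen_factor (hS : CSS S) {x a b : S} (hx : dm x ≠ rg x) (ha : a ∈ genInv ({x} : Set S))
    (hb : b ∈ genInv ({x} : Set S)) (hab : a * b = x) : a = x ∨ b = x := by
  have step : ∀ x a b : S, dm x ≠ rg x → a ∈ genInv ({x} : Set S) → a * b = x →
      a = dm x ∨ a = x := by
    intro x a b hx ha hab
    have h1 : dm x * dm a = dm x := by
      conv_lhs => rw [← hab]
      conv_rhs => rw [← hab]
      exact dm_mul_le a b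
    rcases gen_mono_cases ha with h | h | h | h
    · exact absurd (le_trans' h1 h) (pq_ne hS hx)
    · exact absurd (le_antisymm' (dm_idem _) (dm_idem _) (dm_mul_le x x) (le_trans' h1 h))
        (dm_sq_ne hS hx)
    · exact Or.inl h
    · exact Or.inr h
  rcases step x a b hx ha hab with h | h
  · have h2 := step x⁻¹ b⁻¹ a⁻¹ (by rw [dm_inv, rg_inv]; exact hx.symm)
      (by rw [gen_inv]; exact (gen_sub _).2 _ hb) (by rw [← inv_mul', hab])
    rcases h2 with h2 | h2
    · exfalso
      have : b = rg x := by
        rw [← inv_inv' b, h2, dm_inv, idem_inv (rg_idem x)]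
      rw [h, this] at hab
      have hi : IsIdempotentElem x := by
        rw [← hab]; exact idem_mul (dm_idem x) (rg_idem x)
      exact hx (by rw [dm_of_idem hi, rg_of_idem hi])
    · right; rw [← inv_inv' b, h2, inv_inv']
  · exact Or.inl h

theorem gen_minus_sub (hS : CSS S) {x : S} (hx : dm x ≠ rg x) :
    IsInvSub (genInv ({x} : Set S) \ {x, x⁻¹}) := by
  refine ⟨?_, ?_⟩
  · rintro a ⟨ha, ha'⟩ b ⟨hb, hb'⟩
    simp only [Set.mem_insert_iff, Set.mem_singleton_iff, not_or] at ha' hb'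
    refine ⟨(gen_sub _).1 _ ha _ hb, ?_⟩
    rintro (h | h)
    · rcases gen_factor hS hx ha hb h with h | h
      · exact ha'.1 h
      · exact hb'.1 h
    · have h : b⁻¹ * a⁻¹ = x := by rw [← inv_mul', h, inv_inv']
      rcases gen_factor hS hx ((gen_sub _).2 _ hb) ((gen_sub _).2 _ ha) h with h | h
      · exact hb'.2 (by rw [← h, inv_inv'])
      · exact ha'.2 (by rw [← h, inv_inv'])
  · rintro a ⟨ha, ha'⟩
    simp only [Set.mem_insert_iff, Set.mem_singleton_iff, not_or] at ha'
    refine ⟨(gen_sub _).2 _ ha, ?_⟩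
    rintro (h | h)
    · exact ha'.2 (by rw [← h, inv_inv'])
    · exact ha'.1 (by rw [← inv_inv' a, h, inv_inv'])

/-- groupoid lemma -/
theorem groupoid {K : Set S} (hK : IsInvSub K) {e c h : S} (he : IsIdempotentElem e)
    (heK : e ∈ K) (hKd : ∀ k ∈ K, dm k = e)
    (hc : dm c = e) (hc1 : e * rg c ≠ e) (hc2 : rg c * e ≠ rg c)
    (hh1 : dm h = e) (hh2 : rg h = e)
    (hmem : h * c ∈ genInv (K ∪ {c})) : h ∈ K := by
  have hKr : ∀ k ∈ K, rg k = e := fun k hk => by rw [← dm_inv]; exact hKd _ (hK.2 k hk)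
  set A : Set S := {a | a ∈ K ∨ ∃ k ∈ K, a = k * c} with hA
  have hrgkc : ∀ k ∈ K, rg (k * c) = rg c := by
    intro k hk
    have := (dm_mul_eq_iff c⁻¹ k⁻¹).2 (by rw [rg_inv, dm_inv, hc, hKr k hk]; exact he)
    rwa [← inv_mul', dm_inv, dm_inv] at this
  have hcK : ∀ k ∈ K, ∀ l, dm l = e → dm (k * c) = e → dm (k * c * l) = e → False := by
    intro k hk l hl h1 h2
    have := (dm_mul_eq_iff (k * c) l).1 (by rw [h1, h2])
    rw [hrgkc k hk, hl] at this
    exact hc2 this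
  have hhc : h * c ∈ A := by
    apply walk (X := K ∪ {c}) he (Or.inl heK) _ _ hmem
    · rw [← hh1, dm_mul_eq_iff, hh2, hc]; exact he
    · rintro x (hx | hx) a (ha | ⟨k, hk, rfl⟩) h1 h2
      · exact Or.inl (hK.1 _ ha _ hx)
      · exact (hcK k hk x (hKd x hx) h1 h2).elim
      · rw [hx]; exact Or.inr ⟨a, ha, rfl⟩
      · rw [hx] at h2 ⊢; exact (hcK k hk c hc h1 h2).elim
    · rintro x (hx | hx) a (ha | ⟨k, hk, rfl⟩) h1 h2
      · exact Or.inl (hK.1 _ ha _ (hK.2 _ hx))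
      · exact (hcK k hk x⁻¹ (hKd _ (hK.2 x hx)) h1 h2).elim
      · rw [hx] at h2 ⊢
        have := (dm_mul_eq_iff a c⁻¹).1 (by rw [h1, h2])
        rw [hKr a ha, dm_inv] at this
        exact (hc1 this).elim
      · rw [hx]
        left
        have : k * c * c⁻¹ = k := by
          rw [mul_assoc]; show k * dm c = k
          rw [hc, ← hKr k hk, mul_rg_self]
        rw [this]; exact hk
  have hback : h * c * c⁻¹ = h := by
    rw [mul_assoc]; show h * dm c = h
    rw [hc, ← hh2, mul_rg_self]
  rcases hhc with h1 | ⟨k, hk, h1⟩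
  · exfalso
    have h2 := hKr _ h1
    have : rg (h * c) = rg c := by
      have := (dm_mul_eq_iff c⁻¹ h⁻¹).2 (by rw [rg_inv, dm_inv, hc, hh2]; exact he)
      rwa [← inv_mul', dm_inv, dm_inv] at this
    rw [h2] at this
    apply hc1
    rw [← this]; exact he
  · have : k * c * c⁻¹ = k := by
      rw [mul_assoc]; show k * dm c = k
      rw [hc, ← hKr k hk, mul_rg_self]
    rw [← hback, h1, this]; exact hk

end Basic

section Pw

variable {S : Type*} [InverseSemigroup S]

def pw (s : S) : ℕ → S
  | 0 => dm s
  | n + 1 => pw s n * s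

theorem pw_zero (s : S) : pw s 0 = dm s := rfl

theorem pw_succ (s : S) (n : ℕ) : pw s (n + 1) = pw s n * s := rfl

theorem pw_comm {s : S} (hs : rg s * dm s = rg s) (n : ℕ) : s * pw s n = pw s (n + 1) := by
  induction n with
  | zero => rw [pw_succ, pw_zero, mul_of_rg_le hs, dm_mul_self]
  | succ n ih => rw [pw_succ, ← mul_assoc, ih, ← pw_succ]

theorem pw_rg_le {s : S} (hs : rg s * dm s = rg s) (n : ℕ) : rg (pw s n) * dm s = rg (pw s n) := by
  cases n with
  | zero => rw [pw_zero, rg_of_idem (dm_idem s)]; exact dm_idem s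
  | succ n => exact le_trans' (rg_mul_le _ _) hs

theorem pw_dm {s : S} (hs : rg s * dm s = rg s) (n : ℕ) : dm (pw s n) = dm s := by
  induction n with
  | zero => rw [pw_zero, dm_of_idem (dm_idem s)]
  | succ n ih => rw [pw_succ, (dm_mul_eq_iff _ _).2 (pw_rg_le hs n), ih]

theorem pw_anti {s : S} (hs : rg s * dm s = rg s) {m n : ℕ} (h : m ≤ n) : rg (pw s n) * rg (pw s m) = rg (pw s n) := by
  induction n, h using Nat.le_induction with
  | base => exact rg_idem _
  | succ n _ ih =>
    refine le_trans' ?_ ih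
    rw [← pw_comm hs n]; exact rg_mul_le _ _

theorem pw_succ_ne {s : S} (hs : rg s * dm s = rg s) (hne : rg s ≠ dm s) (n : ℕ) : rg (pw s (n + 1)) ≠ rg (pw s n) := by
  intro h
  apply hne
  have h1 : pw s n * rg (pw s (n + 1)) * (pw s n)⁻¹ = dm (pw s n) * rg s * dm (pw s n) := by
    rw [← pw_comm hs n]
    simp only [rg, dm, inv_mul', mul_assoc]
  have h2 : pw s n * rg (pw s n) * (pw s n)⁻¹ = dm (pw s n) := by
    rw [mul_rg_self]; rfl
  rw [h, h2, pw_dm hs n, idem_comm (dm_idem s) (rg_idem s), hs, hs] at h1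
  exact h1.symm

theorem pw_inj {s : S} (hs : rg s * dm s = rg s) (hne : rg s ≠ dm s) {m n : ℕ} (h : rg (pw s m) = rg (pw s n)) : m = n := by
  have key : ∀ m n : ℕ, m < n → rg (pw s m) = rg (pw s n) → False := by
    intro m n hlt h
    apply pw_succ_ne hs hne m
    apply le_antisymm' (rg_idem _) (rg_idem _) (pw_anti hs (Nat.le_succ m))
    rw [h]; exact pw_anti hs hlt
  rcases lt_trichotomy m n with h1 | h1 | h1
  · exact (key _ _ h1 h).elim
  · exact h1
  · exact (key _ _ h1 h.symm).elim

theorem pw_form {s : S} (hs : rg s * dm s = rg s) {w : S} (hw : w ∈ genInv ({s} : Set S)) : ∃ m n, w = (pw s m)⁻¹ * pw s n := by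
  have h1 : dm s * w = w := by
    apply mul_of_le_dm (dm_idem s)
    rcases gen_le_cases hw with h | h
    · exact h
    · exact le_trans' h hs
  have := gen_act (X := {s}) (P := fun w => ∃ m n, w = (pw s m)⁻¹ * pw s n)
    (by
      rintro x rfl a ⟨m, n, rfl⟩
      exact ⟨m, n + 1, by rw [pw_succ, mul_assoc]⟩)
    (by
      rintro x rfl a ⟨m, n, rfl⟩
      cases n with
      | zero =>
        refine ⟨m + 1, 0, ?_⟩
        have h3 : dm x * pw x (m + 1) = pw x (m + 1) := by
          rw [← pw_dm hs (m + 1), dm_mul_self]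
        have h2 : (pw x (m + 1))⁻¹ * dm x = (pw x (m + 1))⁻¹ := by
          conv_rhs => rw [← h3, inv_mul', idem_inv (dm_idem x)]
        rw [pw_zero, h2, ← pw_comm hs m, inv_mul', mul_assoc]
        congr 1
        have : (x * dm x)⁻¹ = x⁻¹ := by rw [mul_of_rg_le hs]
        rwa [inv_mul', idem_inv (dm_idem x)] at this
      | succ n =>
        refine ⟨m, n, ?_⟩
        rw [pw_succ, mul_assoc, mul_assoc]
        show _ * (_ * dm x) = _
        rw [mul_of_rg_le (pw_rg_le hs n)])
    hw (dm s) ⟨0, 0, by rw [pw_zero]; exact (rg_of_idem (dm_idem s)).symm⟩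
  rwa [h1] at this

theorem pw_form_dm {s : S} (hs : rg s * dm s = rg s) (m n : ℕ) : dm ((pw s m)⁻¹ * pw s n) = rg (pw s m) := by
  rw [← dm_inv]
  apply (dm_mul_eq_iff _ _).2
  rw [rg_inv, pw_dm hs, pw_dm hs]; exact dm_idem s

theorem pw_form_rg {s : S} (hs : rg s * dm s = rg s) (m n : ℕ) : rg ((pw s m)⁻¹ * pw s n) = rg (pw s n) := by
  rw [← dm_inv, inv_mul', inv_inv']
  exact pw_form_dm hs n m

theorem pw_chain {s : S} (hs : rg s * dm s = rg s) {e f : S} (he : e ∈ genInv ({s} : Set S)) (hf : f ∈ genInv ({s} : Set S))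
    (hei : IsIdempotentElem e) (hfi : IsIdempotentElem f) : e * f = e ∨ f * e = f := by
  obtain ⟨m, n, h1⟩ := pw_form hs he
  obtain ⟨m', n', h2⟩ := pw_form hs hf
  have h3 : e = rg (pw s m) := by
    rw [← pw_form_dm hs m n, ← h1, dm_of_idem hei]
  have h4 : f = rg (pw s m') := by
    rw [← pw_form_dm hs m' n', ← h2, dm_of_idem hfi]
  rw [h3, h4]
  rcases le_total m m' with h | h
  · exact Or.inr (pw_anti hs h)
  · exact Or.inl (pw_anti hs h)

theorem pw_group {s : S} (hs : rg s * dm s = rg s) (hne : rg s ≠ dm s) {w : S} (hw : w ∈ genInv ({s} : Set S))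
    (h : dm w = rg w) : w = dm w := by
  obtain ⟨m, n, h1⟩ := pw_form hs hw
  have h2 : rg (pw s m) = rg (pw s n) := by
    rw [← pw_form_dm hs m n, ← pw_form_rg hs m n, ← h1, h]
  have := pw_inj hs hne h2
  rw [this] at h1
  have hi : IsIdempotentElem w := by rw [h1]; exact rg_idem _
  rw [dm_of_idem hi]

end Pw

/-- symmetric packaging of a lattice isomorphism with semilattice isomorphism -/
structure LI (S T : Type*) [InverseSemigroup S] [InverseSemigroup T] where
  F : Set S → Set T
  G : Set T → Set S
  p : S → T
  q : T → S
  F_sub : ∀ {U}, IsInvSub U → IsInvSub (F U)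
  G_sub : ∀ {U}, IsInvSub U → IsInvSub (G U)
  GF : ∀ {U}, IsInvSub U → G (F U) = U
  FG : ∀ {U}, IsInvSub U → F (G U) = U
  F_mono : ∀ {U V}, IsInvSub U → IsInvSub V → U ⊆ V → F U ⊆ F V
  G_mono : ∀ {U V}, IsInvSub U → IsInvSub V → U ⊆ V → G U ⊆ G V
  p_idem : ∀ {e}, IsIdempotentElem e → IsIdempotentElem (p e)
  q_idem : ∀ {e}, IsIdempotentElem e → IsIdempotentElem (q e)
  qp : ∀ {e}, IsIdempotentElem e → q (p e) = e
  pq : ∀ {e}, IsIdempotentElem e → p (q e) = e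
  F_sing : ∀ {e}, IsIdempotentElem e → F {e} = {p e}
  G_sing : ∀ {e}, IsIdempotentElem e → G {e} = {q e}
  p_mul : ∀ {e f}, IsIdempotentElem e → IsIdempotentElem f → p (e * f) = p e * p f
  q_mul : ∀ {e f}, IsIdempotentElem e → IsIdempotentElem f → q (e * f) = q e * q f

namespace LI

variable {S T : Type*} [InverseSemigroup S] [InverseSemigroup T]

def symm (L : LI S T) : LI T S where
  F := L.G
  G := L.F
  p := L.q
  q := L.p
  F_sub := L.G_sub
  G_sub := L.F_sub
  GF := L.FG
  FG := L.GF
  F_mono := L.G_mono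
  G_mono := L.F_mono
  p_idem := L.q_idem
  q_idem := L.p_idem
  qp := L.pq
  pq := L.qp
  F_sing := L.G_sing
  G_sing := L.F_sing
  p_mul := L.q_mul
  q_mul := L.p_mul

variable (L : LI S T)

theorem F_refl {U V : Set S} (hU : IsInvSub U) (hV : IsInvSub V) (h : L.F U ⊆ L.F V) : U ⊆ V := by
  have := L.G_mono (L.F_sub hU) (L.F_sub hV) h
  rwa [L.GF hU, L.GF hV] at this

theorem p_inj {e f : S} (he : IsIdempotentElem e) (hf : IsIdempotentElem f)
    (h : L.p e = L.p f) : e = f := by rw [← L.qp he, h, L.qp hf]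

theorem p_le {e f : S} (he : IsIdempotentElem e) (hf : IsIdempotentElem f) :
    L.p e * L.p f = L.p e ↔ e * f = e := by
  rw [← L.p_mul he hf]
  exact ⟨fun h => L.p_inj (idem_mul he hf) he h, fun h => by rw [h]⟩

theorem mem_idem {e : S} (he : IsIdempotentElem e) {U : Set S} (hU : IsInvSub U) :
    e ∈ U ↔ L.p e ∈ L.F U := by
  constructor
  · intro h
    have := L.F_mono (sing_sub he) hU (by simpa using h)
    rw [L.F_sing he] at this
    simpa using this
  · intro h
    have : L.F {e} ⊆ L.F U := by rw [L.F_sing he]; simpa using h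
    have := L.F_refl (sing_sub he) hU this
    simpa using this

theorem mem_q {g : T} (hg : IsIdempotentElem g) {U : Set S} (hU : IsInvSub U)
    (h : g ∈ L.F U) : L.q g ∈ U := by
  rw [L.mem_idem (L.q_idem hg) hU, L.pq hg]; exact h

theorem single {V : Set S} (hV : IsInvSub V) {e : S} (h : ∀ v ∈ V, dm v = e) :
    ∀ t ∈ L.F V, dm t = L.p e := by
  intro t ht
  have h1 := L.mem_q (dm_idem t) hV (sub_dm (L.F_sub hV) ht)
  have h2 := h _ h1
  rw [dm_of_idem (L.q_idem (dm_idem t))] at h2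
  rw [← h2, L.pq (dm_idem t)]

theorem _root_.IS.gen_group {u e : S} (h1 : dm u = e) (h2 : rg u = e) :
    ∀ v ∈ genInv ({u} : Set S), dm v = e := by
  have he : IsIdempotentElem e := by rw [← h1]; exact dm_idem u
  have : IsInvSub {v : S | dm v = e ∧ rg v = e} := by
    refine ⟨?_, ?_⟩
    · rintro a ⟨ha, ha'⟩ b ⟨hb, hb'⟩
      refine ⟨?_, ?_⟩
      · rw [← ha, dm_mul_eq_iff, ha', hb]; exact he
      · have := (dm_mul_eq_iff b⁻¹ a⁻¹).2 (by rw [rg_inv, dm_inv, ha', hb]; exact he)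
        rw [← inv_mul', dm_inv, dm_inv] at this
        rw [this, hb']
    · rintro a ⟨ha, ha'⟩
      exact ⟨by rw [dm_inv]; exact ha', by rw [rg_inv]; exact ha⟩
  exact fun v hv => (gen1_le this ⟨h1, h2⟩ hv).1

theorem css_transfer (L : LI S T) (hS : CSS S) : CSS T := by
  intro a ha
  by_contra hne
  set C := genInv ({a} : Set T) with hC
  have hCs : IsInvSub C := gen_sub _
  set U := L.G C with hU
  have hUs : IsInvSub U := L.G_sub hCs
  have hFU : L.F U = C := L.FG hCs
  have hidem : ∀ u ∈ U, IsIdempotentElem u := by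
    intro u hu
    have h1 : L.p (dm u) ∈ C := by
      rw [← hFU, ← L.mem_idem (dm_idem u) hUs]; exact sub_dm hUs hu
    have h2 : L.p (rg u) ∈ C := by
      rw [← hFU, ← L.mem_idem (rg_idem u) hUs]; exact sub_rg hUs hu
    have h3 : rg u = dm u := by
      rcases pw_chain ha h1 h2 (L.p_idem (dm_idem u)) (L.p_idem (rg_idem u)) with h | h
      · exact hS.symm ((L.p_le (dm_idem u) (rg_idem u)).1 h)
      · exact hS u ((L.p_le (rg_idem u) (dm_idem u)).1 h)
    have h4 := L.single (gen_sub {u}) (gen_group rfl h3)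
    have h5 : L.F (genInv {u}) ⊆ L.F {dm u} := by
      intro t ht
      rw [L.F_sing (dm_idem u)]
      have htC : t ∈ C := by
        rw [← hFU]; exact L.F_mono (gen_sub _) hUs (gen1_le hUs hu) ht
      have h6 := h4 t ht
      have h7 := h4 _ ((L.F_sub (gen_sub _)).2 t ht)
      rw [dm_inv] at h7
      rw [Set.mem_singleton_iff, ← h6]
      exact pw_group ha hne htC (by rw [h6, h7])
    have h6 := L.F_refl (gen_sub _) (sing_sub (dm_idem u)) h5 (mem_gen u)
    rw [Set.mem_singleton_iff] at h6
    rw [h6]; exact dm_idem u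
  have hECs : IsInvSub {t : T | t ∈ C ∧ IsIdempotentElem t} :=
    ⟨fun x hx y hy => ⟨hCs.1 _ hx.1 _ hy.1, idem_mul hx.2 hy.2⟩,
      fun x hx => ⟨hCs.2 _ hx.1, by rw [idem_inv hx.2]; exact hx.2⟩⟩
  have hsub : U ⊆ L.G {t : T | t ∈ C ∧ IsIdempotentElem t} := by
    intro u hu
    have hi := hidem u hu
    rw [L.mem_idem hi (L.G_sub hECs), L.FG hECs]
    refine ⟨?_, L.p_idem hi⟩
    rw [← hFU, ← L.mem_idem hi hUs]; exact hu
  have h8 := L.F_mono hUs (L.G_sub hECs) hsub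
  rw [hFU, L.FG hECs] at h8
  have h9 := (h8 (mem_gen a)).2
  exact hne (by rw [dm_of_idem h9, rg_of_idem h9])

/-- the basic relation between elements -/
def R (x : S) (y : T) : Prop :=
  L.F (genInv {x}) = genInv {y} ∧ L.p (dm x) = dm y ∧ L.p (rg x) = rg y

variable {L}

theorem R.symm {x : S} {y : T} (h : L.R x y) : L.symm.R y x := by
  obtain ⟨h1, h2, h3⟩ := h
  refine ⟨?_, ?_, ?_⟩
  · show L.G _ = _
    rw [← h1, L.GF (gen_sub _)]
  · show L.q _ = _
    rw [← h2, L.qp (dm_idem x)]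
  · show L.q _ = _
    rw [← h3, L.qp (rg_idem x)]

theorem R.inv {x : S} {y : T} (h : L.R x y) : L.R x⁻¹ y⁻¹ := by
  obtain ⟨h1, h2, h3⟩ := h
  exact ⟨by rw [gen_inv, gen_inv, h1], by rw [dm_inv, dm_inv, h3], by rw [rg_inv, rg_inv, h2]⟩

theorem R.mem {x : S} {y : T} (h : L.R x y) {U : Set S} (hU : IsInvSub U) :
    x ∈ U ↔ y ∈ L.F U := by
  constructor
  · intro hx
    have := L.F_mono (gen_sub _) hU (gen1_le hU hx)
    rw [h.1] at this
    exact this (mem_gen y)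
  · intro hy
    have : L.F (genInv {x}) ⊆ L.F U := by rw [h.1]; exact gen1_le (L.F_sub hU) hy
    exact L.F_refl (gen_sub _) hU this (mem_gen x)

theorem R_idem {e : S} (he : IsIdempotentElem e) : L.R e (L.p e) := by
  refine ⟨?_, ?_, ?_⟩
  · rw [gen_idem he, gen_idem (L.p_idem he), L.F_sing he]
  · rw [dm_of_idem he, dm_of_idem (L.p_idem he)]
  · rw [rg_of_idem he, rg_of_idem (L.p_idem he)]

theorem R_idem_eq {e : S} (he : IsIdempotentElem e) {t : T} (h : L.R e t) : t = L.p e := by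
  have := mem_gen t
  rw [← h.1, gen_idem he, L.F_sing he] at this
  exact this

theorem R.ne {x : S} {y : T} (h : L.R x y) (hx : dm x ≠ rg x) : dm y ≠ rg y := by
  rw [← h.2.1, ← h.2.2]
  exact fun h => hx (L.p_inj (dm_idem x) (rg_idem x) h)

theorem R_exists (L : LI S T) (hS : CSS S) {x : S} (hx : dm x ≠ rg x) : ∃ y, L.R x y := by
  have hMs := gen_minus_sub hS hx
  have hne : ¬ L.F (genInv {x}) ⊆ L.F (genInv ({x} : Set S) \ {x, x⁻¹}) := by
    intro h
    have := L.F_refl (gen_sub _) hMs h (mem_gen x)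
    exact this.2 (Or.inl rfl)
  obtain ⟨y, hy, hy'⟩ := Set.not_subset.1 hne
  have hgy : L.F (genInv {x}) = genInv {y} := by
    apply Set.Subset.antisymm _ (gen1_le (L.F_sub (gen_sub _)) hy)
    have h1 : L.G (genInv {y}) ⊆ genInv {x} := by
      have := L.G_mono (gen_sub _) (L.F_sub (gen_sub _)) (gen1_le (L.F_sub (gen_sub {x})) hy)
      rwa [L.GF (gen_sub _)] at this
    have h2 : x ∈ L.G (genInv {y}) := by
      by_contra hxn
      apply hy'
      have h3 : L.G (genInv {y}) ⊆ genInv ({x} : Set S) \ {x, x⁻¹} := by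
        intro z hz
        refine ⟨h1 hz, ?_⟩
        rintro (h | h)
        · exact hxn (h ▸ hz)
        · apply hxn
          have := (L.G_sub (gen_sub {y})).2 _ hz
          rwa [h, inv_inv'] at this
      have := L.F_mono (L.G_sub (gen_sub _)) hMs h3
      rw [L.FG (gen_sub _)] at this
      exact this (mem_gen y)
    have := L.F_mono (gen_sub _) (L.G_sub (gen_sub _)) (gen1_le (L.G_sub (gen_sub _)) h2)
    rwa [L.FG (gen_sub _)] at this
  -- comparing maximal idempotents
  have i1 := L.p_idem (dm_idem x)
  have i2 := L.p_idem (rg_idem x)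
  have n1 : ¬ L.p (dm x) * L.p (rg x) = L.p (dm x) := by
    rw [L.p_le (dm_idem x) (rg_idem x)]; exact pq_ne hS hx
  have n2 : ¬ L.p (rg x) * L.p (dm x) = L.p (rg x) := by
    rw [L.p_le (rg_idem x) (dm_idem x)]; exact fun h => hx (hS x h).symm
  have up : ∀ g, IsIdempotentElem g → g ∈ genInv ({y} : Set T) →
      g * L.p (dm x) = g ∨ g * L.p (rg x) = g := by
    intro g hg hm
    rw [← hgy] at hm
    have h1 := L.mem_q hg (gen_sub _) hm
    have h2 := gen_le_cases h1
    rw [dm_of_idem (L.q_idem hg), ← L.p_le (L.q_idem hg) (dm_idem x),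
      ← L.p_le (L.q_idem hg) (rg_idem x), L.pq hg] at h2
    exact h2
  have d1 := gen_le_cases (y := y) (w := L.p (dm x)) (by
    rw [← hgy, ← L.mem_idem (dm_idem x) (gen_sub _)]; exact sub_dm (gen_sub _) (mem_gen x))
  have d2 := gen_le_cases (y := y) (w := L.p (rg x)) (by
    rw [← hgy, ← L.mem_idem (rg_idem x) (gen_sub _)]; exact sub_rg (gen_sub _) (mem_gen x))
  rw [dm_of_idem i1] at d1
  rw [dm_of_idem i2] at d2
  have u1 := up _ (dm_idem y) (sub_dm (gen_sub _) (mem_gen y))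
  have u2 := up _ (rg_idem y) (sub_rg (gen_sub _) (mem_gen y))
  rcases d1 with d1 | d1
  · have e1 : L.p (dm x) = dm y := by
      rcases u1 with u | u
      · exact le_antisymm' i1 (dm_idem y) d1 u
      · exact absurd (le_trans' d1 u) n1
    have e2 : L.p (rg x) = rg y := by
      rcases d2 with d2 | d2
      · rw [← e1] at d2; exact absurd d2 n2
      · rcases u2 with u | u
        · exact absurd (le_trans' d2 u) n2
        · exact le_antisymm' i2 (rg_idem y) d2 u
    exact ⟨y, hgy, e1, e2⟩
  · have e1 : L.p (dm x) = rg y := by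
      rcases u2 with u | u
      · exact le_antisymm' i1 (rg_idem y) d1 u
      · exact absurd (le_trans' d1 u) n1
    have e2 : L.p (rg x) = dm y := by
      rcases d2 with d2 | d2
      · rcases u1 with u | u
        · exact absurd (le_trans' d2 u) n2
        · exact le_antisymm' i2 (dm_idem y) d2 u
      · rw [← e1] at d2; exact absurd d2 n2
    exact ⟨y⁻¹, by rw [gen_inv, hgy], by rw [dm_inv, e1], by rw [rg_inv, e2]⟩

theorem R_unique (hT : CSS T) {x : S} {y y' : T} (hx : dm x ≠ rg x) (h : L.R x y)
    (h' : L.R x y') : y' = y := by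
  have hy := h.ne hx
  have h1 : y' ∈ genInv ({y} : Set T) := by rw [← h.1, h'.1]; exact mem_gen y'
  have h2 : dm y' = dm y := by rw [← h.2.1, h'.2.1]
  rcases gen_mono_cases h1 with h3 | h3 | h3 | h3
  · rw [h2] at h3; exact absurd h3 (pq_ne hT hy)
  · rw [h2] at h3
    exact absurd (le_antisymm' (dm_idem _) (dm_idem _) (dm_mul_le y y) h3) (dm_sq_ne hT hy)
  · exfalso
    apply h'.ne hx
    have hi : IsIdempotentElem y' := by rw [h3]; exact dm_idem y
    rw [dm_of_idem hi, rg_of_idem hi]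
  · exact h3

theorem sq_half (L : LI S T) {x : S} {y : T} (hS : CSS S) (h : L.R x y) (hx : dm x ≠ rg x) :
    L.p (dm (x * x)) * rg y = L.p (dm (x * x)) ∨
      L.p (dm (x * x)) * dm (y * y) = L.p (dm (x * x)) := by
  have hm : L.p (dm (x * x)) ∈ genInv ({y} : Set T) := by
    rw [← h.1, ← L.mem_idem (dm_idem _) (gen_sub _)]
    exact sub_dm (gen_sub _) ((gen_sub _).1 _ (mem_gen x) _ (mem_gen x))
  have hi := L.p_idem (dm_idem (x * x))
  have hc : L.p (dm (x * x)) ≠ dm y := by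
    rw [← h.2.1]
    exact fun hh => dm_sq_ne hS hx (L.p_inj (dm_idem _) (dm_idem _) hh)
  rcases gen_mono_cases hm with h3 | h3 | h3 | h3
  · rw [dm_of_idem hi] at h3; exact Or.inl h3
  · rw [dm_of_idem hi] at h3; exact Or.inr h3
  · exact absurd h3 hc
  · exfalso; apply hc
    rw [← dm_of_idem hi, h3]

theorem R.sq {x : S} {y : T} (hS : CSS S) (hT : CSS T) (h : L.R x y) (hx : dm x ≠ rg x) :
    L.p (dm (x * x)) = dm (y * y) := by
  have hy := h.ne hx
  have i := L.p_idem (dm_idem (x * x))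
  have key : L.p (dm (x * x)) * rg y = L.p (dm (x * x)) → dm (y * y) * rg y = dm (y * y) →
      L.p (dm (x * x)) = dm (y * y) := by
    intro h1 h2
    have h3 : dm (x * x) * rg x = dm (x * x) := by
      rw [← L.p_le (dm_idem _) (rg_idem x), h.2.2]; exact h1
    rw [deg_a hS h3, deg_a hT h2, L.p_mul (dm_idem x) (rg_idem x), h.2.1, h.2.2]
  have a1 := sq_half L hS h hx
  have a2 : dm (y * y) * rg y = dm (y * y) ∨ dm (y * y) * L.p (dm (x * x)) = dm (y * y) := by
    have b := sq_half L.symm hT h.symm hy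
    change L.q (dm (y * y)) * rg x = L.q (dm (y * y)) ∨
      L.q (dm (y * y)) * dm (x * x) = L.q (dm (y * y)) at b
    rw [← L.p_le (L.q_idem (dm_idem _)) (rg_idem _), ← L.p_le (L.q_idem (dm_idem _)) (dm_idem _),
      L.pq (dm_idem _), h.2.2] at b
    exact b
  rcases a1 with a1 | a1
  · rcases a2 with a2 | a2
    · exact key a1 a2
    · exact key a1 (le_trans' a2 a1)
  · rcases a2 with a2 | a2
    · exact key (le_trans' a1 a2) a2
    · exact le_antisymm' i (dm_idem _) a1 a2

theorem _root_.IS.rg_pq (y : S) : rg (dm y * rg y * y) = rg (y * y) := by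
  rw [← conj_eq (idem_mul (dm_idem y) (rg_idem y))]
  simp only [dm, rg, inv_mul', mul_assoc, imi']

theorem _root_.IS.rg_sq (y : S) : rg (dm (y * y) * y) = dm y * rg y := by
  rw [← conj_eq (dm_idem _)]
  have h1 : y⁻¹ * dm (y * y) * y = rg y * dm y * rg y := by
    simp only [dm, rg, inv_mul', mul_assoc]
  rw [h1, mul_le_left (rg_idem y) (dm_idem y), idem_comm (rg_idem y) (dm_idem y)]

theorem _root_.IS.rg_pq_inv (y : S) : rg (dm y * rg y * y⁻¹) = dm (y * y) := by
  have := rg_pq y⁻¹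
  rwa [← inv_mul', rg_inv (y * y), dm_inv, rg_inv, idem_comm (rg_idem y) (dm_idem y)] at this

theorem R.sq' {x : S} {y : T} (hS : CSS S) (hT : CSS T) (h : L.R x y) (hx : dm x ≠ rg x) :
    L.p (rg (x * x)) = rg (y * y) := by
  have := h.inv.sq hS hT (by rw [dm_inv, rg_inv]; exact hx.symm)
  rwa [← inv_mul', ← inv_mul', dm_inv, dm_inv] at this

theorem _root_.IS.walk2 {g y : S} {A : Set S} (hg : IsIdempotentElem g) (hgA : g ∈ A)
    (h : ∀ a ∈ A, dm a = g → dm (a * y) = g → a * y ∈ A)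
    (h' : ∀ a ∈ A, dm a = g → dm (a * y⁻¹) = g → a * y⁻¹ ∈ A)
    {w : S} (hw : w ∈ genInv ({g, y} : Set S)) (hwg : dm w = g) : w ∈ A := by
  have key : ∀ a ∈ A, dm a = g → dm (a * g) = g → a * g ∈ A := by
    intro a ha h1 h2
    have := (dm_mul_eq_iff a g).1 (by rw [h1, h2])
    rw [dm_of_idem hg] at this
    rw [mul_of_rg_le this]; exact ha
  apply walk hg hgA _ _ hw hwg
  · rintro x (rfl | rfl)
    · exact key
    · exact h
  · rintro x (rfl | rfl)
    · rw [idem_inv hg]; exact key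
    · exact h'

theorem R.cover {x : S} {y : T} (hS : CSS S) (hT : CSS T) (h : L.R x y) (hx : dm x ≠ rg x)
    {f : S} (hf : IsIdempotentElem f) (hfle : f * dm x = f)
    (hcov : ∀ e ∈ genInv ({x} : Set S), IsIdempotentElem e → f * e = f → e * dm x = e →
      e ≠ dm x → f = e)
    (hnr : dm (f * x) ≠ rg (f * x) ∨ IsIdempotentElem (f * x)) :
    L.R (f * x) (L.p f * y) := by
  have hy := h.ne hx
  have hxm := mem_gen x
  have hgs := gen_sub ({x} : Set S)
  set g := L.p f with hgdef
  have hg : IsIdempotentElem g := L.p_idem hf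
  have hgle : g * dm y = g := by
    rw [← h.2.1, hgdef, L.p_le hf (dm_idem x)]; exact hfle
  have hdf : dm (f * x) = f := by rw [dm_idem_mul hf, hfle]
  have hdg : dm (g * y) = g := by rw [dm_idem_mul hg, hgle]
  have hq : f * rg x = f → f = dm x * rg x := by
    intro hh
    apply hcov _ (hgs.1 _ (sub_dm hgs hxm) _ (sub_rg hgs hxm)) (idem_mul (dm_idem x) (rg_idem x))
      (le_mul' hfle hh) (mul_le_left (dm_idem x) (rg_idem x)) (pq_ne hS hx)
  have hsq : f * dm (x * x) = f → f = dm (x * x) := by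
    intro hh
    exact hcov _ (sub_dm hgs (hgs.1 _ hxm _ hxm)) (dm_idem _) hh (dm_mul_le x x) (dm_sq_ne hS hx)
  have hpq : L.p (dm x * rg x) = dm y * rg y := by
    rw [L.p_mul (dm_idem x) (rg_idem x), h.2.1, h.2.2]
  rcases hnr with hn | hi
  · obtain ⟨z, hz⟩ := R_exists L hS hn
    have hzn := hz.ne hn
    have hzd : dm z = g := by rw [← hz.2.1, hdf]
    have hzr : L.p (rg (f * x)) = rg z := hz.2.2
    have hzm : z ∈ genInv ({g, y} : Set T) := by
      have hW := gen_sub ({g, y} : Set T)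
      have h1 : f ∈ L.G (genInv {g, y}) := by
        rw [L.mem_idem hf (L.G_sub hW), L.FG hW]
        exact subset_gen _ (Or.inl rfl)
      have h2 : x ∈ L.G (genInv {g, y}) := by
        rw [h.mem (L.G_sub hW), L.FG hW]
        exact subset_gen _ (Or.inr rfl)
      have h3 := (hz.mem (L.G_sub hW)).1 ((L.G_sub hW).1 _ h1 _ h2)
      rwa [L.FG hW] at h3
    have hzg : z ≠ g := by
      intro hh
      apply hzn
      rw [hh, dm_of_idem hg, rg_of_idem hg]
    have hyback : g * y * y⁻¹ = g := by rw [mul_assoc]; exact hgle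
    suffices hfin : z = g * y by rw [← hfin]; exact hz
    by_cases c1 : f * rg x = f
    · have hfe := hq c1
      have hge : g = dm y * rg y := by rw [hgdef, hfe, hpq]
      have hndeg : dm (y * y) ≠ dm y * rg y := by
        intro hd
        apply hzn
        have : rg (f * x) = rg (x * x) := by rw [hfe, rg_pq]
        rw [← hzr, this, h.sq' hS hT hx, deg_inv hd, hzd, hge]
      have hyback2 : g * y⁻¹ * y = g := by
        rw [mul_assoc]; show g * rg y = g
        rw [hge]; exact mul_le_right (rg_idem y)
      have hmem : z ∈ ({g, g * y, g * y⁻¹} : Set T) := by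
        apply walk2 hg (Or.inl rfl) _ _ hzm hzd
        · rintro a (rfl | rfl | rfl) h1 h2
          · exact Or.inr (Or.inl rfl)
          · exfalso
            rw [mul_assoc, dm_idem_mul hg, hge] at h2
            exact hndeg (deg_b hT h2)
          · rw [hyback2]; exact Or.inl rfl
        · rintro a (rfl | rfl | rfl) h1 h2
          · exact Or.inr (Or.inr rfl)
          · rw [hyback]; exact Or.inl rfl
          · exfalso
            rw [mul_assoc, dm_idem_mul hg, hge, ← inv_mul', dm_inv] at h2
            exact hndeg (deg_d hT h2)
      rcases hmem with hh | hh | hh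
      · exact absurd hh hzg
      · exact hh
      · exfalso
        have h1 : rg z = rg (y * y) := by
          rw [← hzr, hfe, rg_pq, h.sq' hS hT hx]
        have h2 : rg z = dm (y * y) := by
          rw [hh, hge, rg_pq_inv]
        apply hndeg
        apply deg_a hT
        rw [← h2, h1]; exact rg_mul_le y y
    · have c1' : g * rg y ≠ g := by
        rw [← h.2.2, hgdef, Ne, L.p_le hf (rg_idem x)]; exact c1
      by_cases c2 : f * dm (x * x) = f
      · have hfe := hsq c2
        have hge : g = dm (y * y) := by rw [hgdef, hfe, h.sq hS hT hx]
        have hndeg : dm (y * y) ≠ dm y * rg y := by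
          intro hd
          apply c1'
          rw [hge, hd]; exact mul_le_right (rg_idem y)
        have hgyy : g * y * y = y * y := by rw [mul_assoc, hge, dm_mul_self]
        have hmem : z ∈ ({g, g * y, g * y * y} : Set T) := by
          apply walk2 hg (Or.inl rfl) _ _ hzm hzd
          · rintro a (rfl | rfl | rfl) h1 h2
            · exact Or.inr (Or.inl rfl)
            · exact Or.inr (Or.inr rfl)
            · exfalso
              rw [hgyy, hge, dm_mul_eq_iff] at h2
              exact hndeg (deg_c hT h2)
          · rintro a (rfl | rfl | rfl) h1 h2
            · exfalso
              rw [dm_idem_mul hg, dm_inv] at h2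
              exact c1' h2
            · rw [hyback]; exact Or.inl rfl
            · right; left
              have h3 : rg (g * y) * dm y = rg (g * y) := by
                rw [hge, rg_sq]; exact mul_le_left (dm_idem y) (rg_idem y)
              rw [mul_assoc]; show g * y * dm y = g * y
              exact mul_of_rg_le h3
        rcases hmem with hh | hh | hh
        · exact absurd hh hzg
        · exact hh
        · exfalso
          have h1 : rg z = dm y * rg y := by
            rw [← hzr, hfe, rg_sq, hpq]
          rw [hh, hgyy] at h1
          exact hndeg (deg_inv' h1)
      · have c2' : g * dm (y * y) ≠ g := by
          rw [← h.sq hS hT hx, hgdef, Ne, L.p_le hf (dm_idem _)]; exact c2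
        have hmem : z ∈ ({g, g * y} : Set T) := by
          apply walk2 hg (Or.inl rfl) _ _ hzm hzd
          · rintro a (rfl | rfl) h1 h2
            · exact Or.inr rfl
            · exfalso
              rw [mul_assoc, dm_idem_mul hg] at h2
              exact c2' h2
          · rintro a (rfl | rfl) h1 h2
            · exfalso
              rw [dm_idem_mul hg, dm_inv] at h2
              exact c1' h2
            · rw [hyback]; exact Or.inl rfl
        rcases hmem with hh | hh
        · exact absurd hh hzg
        · exact hh
  · have hfx : f * x = f := by rw [← dm_of_idem hi, hdf]
    have hfr : f * rg x = f := by
      have := rg_mul_le f x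
      rwa [hfx, rg_of_idem hf] at this
    have hfe := hq hfr
    have hge : g = dm y * rg y := by rw [hgdef, hfe, hpq]
    have hrx : rg (x * x) = f := by
      rw [← rg_pq, ← hfe, hfx, rg_of_idem hf]
    have hrg : rg (g * y) = g := by
      rw [hge, rg_pq, ← h.sq' hS hT hx, hrx, ← hge]
    have hfx' : f * x⁻¹ = f := by
      have : f * x * x⁻¹ = f := by rw [mul_assoc]; exact hfle
      rwa [hfx] at this
    have hgy : genInv ({g * y} : Set T) ⊆ {g} := by
      apply L.symm.F_refl (gen_sub _) (sing_sub hg)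
      intro v hv
      have hv1 := L.symm.single (gen_sub _) (gen_group hdg hrg) v hv
      have hv2 : v ∈ genInv ({x} : Set S) := by
        have h1 : genInv ({g * y} : Set T) ⊆ genInv {y} := by
          apply gen1_le (gen_sub _)
          rw [hge]
          have hs := gen_sub ({y} : Set T)
          have hm := mem_gen y
          exact hs.1 _ (hs.1 _ (sub_dm hs hm) _ (sub_rg hs hm)) _ hm
        have h2 := L.symm.F_mono (gen_sub _) (gen_sub _) h1 hv
        rw [h.symm.1] at h2
        exact h2
      rw [L.symm.F_sing hg]
      change dm v = L.q g at hv1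
      show v ∈ ({L.q g} : Set S)
      rw [hgdef, L.qp hf] at hv1 ⊢
      apply walk (A := {f}) hf rfl _ _ hv2 hv1
      · rintro _ rfl a rfl _ _; exact hfx
      · rintro _ rfl a rfl _ _; exact hfx'
    have : g * y = g := hgy (mem_gen _)
    rw [hfx, this]; exact R_idem hf

theorem R.restrict {x : S} {y : T} (hTC : TightlyConnected S) (hS : CSS S) (hT : CSS T)
    (h : L.R x y) (hx : dm x ≠ rg x) {f : S} (hf : IsIdempotentElem f) (hfle : f * dm x = f) :
    L.R (f * x) (L.p f * y) := by
  by_cases hne : f = dm x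
  · rw [hne, dm_mul_self, h.2.1, dm_mul_self]; exact h
  obtain ⟨n, hn, es, h0, hlast, hid, hstep⟩ := hTC x (Or.inl hx) f hf ⟨hfle, hne⟩
  have hlast' : es n = dm x := hlast
  have main : ∀ k, k ≤ n → (es (n - k) * dm x = es (n - k) ∧
      (dm (es (n - k) * x) ≠ rg (es (n - k) * x) ∨ IsIdempotentElem (es (n - k) * x)) ∧
      L.R (es (n - k) * x) (L.p (es (n - k)) * y)) := by
    intro k
    induction k with
    | zero =>
      intro _
      rw [Nat.sub_zero, hlast', dm_mul_self, h.2.1, dm_mul_self]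
      exact ⟨dm_idem x, Or.inl hx, h⟩
    | succ k ih =>
      intro hk
      obtain ⟨a1, a2, a3⟩ := ih (by omega)
      obtain ⟨b1, b2, b3⟩ := hstep (n - k) (by omega) (by omega)
      have hidx : n - (k + 1) = n - k - 1 := by omega
      rw [hidx]
      set e := es (n - k) with he
      set d := es (n - k - 1) with hd
      have hei : IsIdempotentElem e := hid _ (by omega)
      have hdi : IsIdempotentElem d := hid _ (by omega)
      have hde : d * e = d := b1.1
      have hdex : d * (e * x) = d * x := by rw [← mul_assoc, hde]
      have hdey : L.p d * (L.p e * y) = L.p d * y := by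
        rw [← mul_assoc, (L.p_le hdi hei).2 hde]
      have hdmex : dm (e * x) = e := by rw [dm_idem_mul hei, a1]
      rw [hdex] at b3
      refine ⟨le_trans' hde a1, b3, ?_⟩
      rcases a2 with a2 | a2
      · rw [← hdex, ← hdey]
        apply a3.cover hS hT a2 hdi (by rw [hdmex]; exact hde)
        · intro c hc hci h1 h2 h3
          by_contra hdc
          exact b2.2 c hc hci ⟨⟨h1, hdc⟩, ⟨h2, h3⟩⟩
        · rw [hdex]; exact b3
      · have hex : e * x = e := by rw [← dm_of_idem a2, hdmex]
        have hpy : L.p e * y = L.p e := by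
          have := R_idem_eq a2 a3
          rwa [hex] at this
        rw [← hdex, ← hdey, hex, hpy, hde, (L.p_le hdi hei).2 hde]
        exact R_idem hdi
  have := (main n le_rfl).2.2
  rwa [Nat.sub_self, h0] at this

/-- Munn compatibility -/
def M (L : LI S T) (x : S) (t : T) : Prop :=
  ∀ e, IsIdempotentElem e → L.p (x⁻¹ * e * x) = t⁻¹ * L.p e * t

theorem R.munn {x : S} {y : T} (hTC : TightlyConnected S) (hS : CSS S) (hT : CSS T)
    (h : L.R x y) (hx : dm x ≠ rg x) : L.M x y := by
  intro e he
  have hi := idem_mul he (dm_idem x)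
  have h1 := h.restrict hTC hS hT hx hi (mul_le_right (dm_idem x))
  have h2 := h1.2.2
  rw [mul_assoc, dm_mul_self, L.p_mul he (dm_idem x), h.2.1, mul_assoc, dm_mul_self] at h2
  rw [conj_eq he, conj_eq (L.p_idem he), h2]

theorem M_idem {e : S} (he : IsIdempotentElem e) : L.M e (L.p e) := by
  intro f hf
  rw [idem_inv he, idem_inv (L.p_idem he), L.p_mul (idem_mul he hf) he, L.p_mul he hf]

theorem M.mul {x x' : S} {t t' : T} (h : L.M x t) (h' : L.M x' t') : L.M (x * x') (t * t') := by
  intro e he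
  have h1 := h' _ (conj_idem he x)
  rw [h e he] at h1
  simpa only [inv_mul', mul_assoc] using h1

theorem M.inj (hF : Fundamental S) {x x' : S} {t : T} (h : L.M x t) (h' : L.M x' t) : x = x' := by
  apply hF
  intro e he
  apply L.p_inj (conj_idem he x) (conj_idem he x')
  rw [h e he, h' e he]

theorem _root_.IS.munn_rg {x y : S} (h : ∀ e, IsIdempotentElem e → x⁻¹ * e * x = y⁻¹ * e * y) :
    rg x = rg y := by
  have key : ∀ x y : S, (∀ e, IsIdempotentElem e → x⁻¹ * e * x = y⁻¹ * e * y) →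
      rg x * rg y = rg x := by
    intro x y h
    have h1 := h (dm x) (dm_idem x)
    have h2 : x⁻¹ * dm x * x = rg x := by rw [mul_assoc, dm_mul_self]; rfl
    rw [h2, conj_eq (dm_idem x)] at h1
    rw [h1]; exact rg_mul_le _ _
  exact le_antisymm' (rg_idem x) (rg_idem y) (key x y h) (key y x (fun e he => (h e he).symm))

theorem _root_.IS.munn_dm {x y : S} (h : ∀ e, IsIdempotentElem e → x⁻¹ * e * x = y⁻¹ * e * y) :
    dm x = dm y := by
  have key : ∀ x y : S, (∀ e, IsIdempotentElem e → x⁻¹ * e * x = y⁻¹ * e * y) →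
      dm y * dm x = dm y := by
    intro x y h
    have h1 := h (dm x) (dm_idem x)
    have h2 : x⁻¹ * dm x * x = rg x := by rw [mul_assoc, dm_mul_self]; rfl
    rw [h2, munn_rg h] at h1
    have h3 : y * (y⁻¹ * dm x * y) * y⁻¹ = dm y * dm x * dm y := by
      simp only [dm, mul_assoc]
    rw [← h1, mul_rg_self, mul_le_left (dm_idem y) (dm_idem x)] at h3
    exact h3.symm
  exact le_antisymm' (dm_idem x) (dm_idem y) (key y x (fun e he => (h e he).symm)) (key x y h)

/-- either trivial H-class, or a nongroup element starting at `e` -/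
theorem _root_.IS.nontriv (hNI : NoIsolatedNontrivial S) {e : S} (he : IsIdempotentElem e) :
    (∀ h : S, dm h = e → rg h = e → h = e) ∨ ∃ c : S, dm c = e ∧ rg c ≠ e := by
  by_cases hh : ∃ h : S, h ≠ e ∧ hRel h e
  · right
    obtain ⟨f, hf, hfe, c, h1, h2⟩ := hNI e he hh
    change dm e = dm c at h1
    change rg c = rg f at h2
    rw [dm_of_idem he] at h1
    rw [rg_of_idem hf] at h2
    exact ⟨c, h1.symm, by rw [h2]; exact hfe⟩
  · left
    intro h h1 h2
    by_contra hne
    apply hh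
    refine ⟨h, hne, ?_, ?_⟩
    · show dm h = dm e
      rw [h1, dm_of_idem he]
    · show rg h = rg e
      rw [h2, rg_of_idem he]

theorem trivial_transfer (L : LI S T) {e : S} (he : IsIdempotentElem e)
    (h : ∀ h : S, dm h = e → rg h = e → h = e) {t : T} (h1 : dm t = L.p e) (h2 : rg t = L.p e) :
    t = L.p e := by
  have h3 : L.symm.F (genInv {t}) ⊆ {e} := by
    intro v hv
    have hs := L.symm.single (gen_sub _) (gen_group h1 h2)
    have a1 := hs v hv
    have a2 := hs _ ((L.symm.F_sub (gen_sub _)).2 v hv)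
    rw [dm_inv] at a2
    change dm v = L.q (L.p e) at a1
    change rg v = L.q (L.p e) at a2
    rw [L.qp he] at a1 a2
    exact h v a1 a2
  have h4 := L.F_mono (L.symm.F_sub (gen_sub _)) (sing_sub he) h3
  change L.F (L.G _) ⊆ _ at h4
  rw [L.FG (gen_sub _), L.F_sing he] at h4
  exact h4 (mem_gen t)

theorem _root_.IS.dm_rg_mul {h c : S} (h1 : rg h = dm c) : dm (h * c) = dm h ∧ rg (h * c) = rg c := by
  refine ⟨(dm_mul_eq_iff h c).2 (by rw [h1]; exact dm_idem c), ?_⟩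
  have := (dm_mul_eq_iff c⁻¹ h⁻¹).2 (by rw [rg_inv, dm_inv, h1]; exact dm_idem c)
  rwa [← inv_mul', dm_inv, dm_inv] at this

theorem T_fund (L : LI S T) (hTC : TightlyConnected S) (hF : Fundamental S) (hS : CSS S)
    (hT : CSS T) (hNI : NoIsolatedNontrivial S) : Fundamental T := by
  have hN : ∀ t t' : T, dm t ≠ rg t →
      (∀ e, IsIdempotentElem e → t⁻¹ * e * t = t'⁻¹ * e * t') → t = t' := by
    intro t t' ht h
    have ht' : dm t' ≠ rg t' := by rw [← munn_dm h, ← munn_rg h]; exact ht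
    obtain ⟨x, hx⟩ := R_exists L.symm hT ht
    obtain ⟨x', hx'⟩ := R_exists L.symm hT ht'
    have nx := hx.ne ht
    have nx' := hx'.ne ht'
    have r : L.R x t := hx.symm
    have r' : L.R x' t' := hx'.symm
    have m := r.munn hTC hS hT nx
    have m' := r'.munn hTC hS hT nx'
    have : x = x' := by
      apply hF
      intro e he
      apply L.p_inj (conj_idem he x) (conj_idem he x')
      rw [m e he, m' e he, h _ (L.p_idem he)]
    rw [← this] at r'
    exact (R_unique hT nx r r').symm
  intro t t' h
  by_cases ht : dm t = rg t
  · have hd := munn_dm h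
    have hr := munn_rg h
    have hqi := L.q_idem (dm_idem t)
    have hpq := L.pq (dm_idem t)
    rcases nontriv hNI hqi with h1 | ⟨c, hc1, hc2⟩
    · rw [L.trivial_transfer hqi h1 (t := t) hpq.symm (by rw [hpq, ht]),
        L.trivial_transfer hqi h1 (t := t') (by rw [hpq, hd]) (by rw [hpq, ht, hr])]
    · have hcn : dm c ≠ rg c := by rw [hc1]; exact hc2.symm
      obtain ⟨d, hd'⟩ := R_exists L hS hcn
      have hdd : dm d = dm t := by rw [← hd'.2.1, hc1, hpq]
      have hdn := hd'.ne hcn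
      obtain ⟨e1, e2⟩ := dm_rg_mul (h := t) (c := d) (by rw [hdd, ht])
      have htd : t * d = t' * d := by
        apply hN
        · rw [e1, e2, ← hdd]; exact hdn
        · intro e he
          have := h e he
          have h5 : d⁻¹ * (t⁻¹ * e * t) * d = d⁻¹ * (t'⁻¹ * e * t') * d := by rw [this]
          simpa only [inv_mul', mul_assoc] using h5
      have b : ∀ s : T, rg s = dm d → s * d * d⁻¹ = s := by
        intro s hs
        rw [mul_assoc]; show s * dm d = s
        rw [← hs, mul_rg_self]
      rw [← b t (by rw [hdd, ht]), ← b t' (by rw [hdd, ht, hr]), htd]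
  · exact hN t t' ht h

theorem group_mem (L : LI S T) (hT : CSS T) {e h c : S} {k d : T} (he : IsIdempotentElem e)
    (h1 : dm h = e) (h2 : rg h = e) (k1 : dm k = L.p e) (k2 : rg k = L.p e)
    (hc : dm c = e) (hcn : dm c ≠ rg c) (hR : L.R c d) (hR' : L.R (h * c) (k * d))
    {U : Set S} (hU : IsInvSub U) (hh : h ∈ U) : k ∈ L.F U := by
  have hV := gen_sub ({h} : Set S)
  have hsub := L.F_mono hV hU (gen1_le hU hh)
  apply hsub
  have hdn := hR.ne hcn
  have hdd : dm d = L.p e := by rw [← hR.2.1, hc]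
  have hpe := L.p_idem he
  have heV : e ∈ genInv ({h} : Set S) := by rw [← h1]; exact sub_dm hV (mem_gen h)
  apply groupoid (L.F_sub hV) hpe ((L.mem_idem he hV).1 heV) (L.single hV (gen_group h1 h2)) hdd
    _ _ k1 k2
  · have hW := gen_sub (L.F (genInv {h}) ∪ {d})
    set W := L.G (genInv (L.F (genInv {h}) ∪ {d})) with hWd
    have hWs : IsInvSub W := L.G_sub hW
    have hFW : L.F W = genInv (L.F (genInv {h}) ∪ {d}) := L.FG hW
    have a1 : h ∈ W := by
      apply L.F_refl hV hWs _ (mem_gen h)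
      rw [hFW]
      exact Set.Subset.trans Set.subset_union_left (subset_gen _)
    have a2 : c ∈ W := by
      rw [hR.mem hWs, hFW]
      exact subset_gen _ (Or.inr rfl)
    rw [← hFW, ← hR'.mem hWs]
    exact hWs.1 _ a1 _ a2
  · rw [← hdd]; exact pq_ne hT hdn
  · rw [← hdd]; exact fun hh => hdn (hT d hh).symm

theorem M_exists (L : LI S T) (hTC : TightlyConnected S) (hS : CSS S) (hT : CSS T)
    (hNI : NoIsolatedNontrivial S) (x : S) : ∃ t, L.M x t := by
  by_cases hx : dm x = rg x
  · rcases nontriv hNI (dm_idem x) with h1 | ⟨c, hc1, hc2⟩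
    · have := h1 x rfl hx.symm
      rw [this]; exact ⟨_, M_idem (dm_idem x)⟩
    · have hcn : dm c ≠ rg c := by rw [hc1]; exact hc2.symm
      obtain ⟨e1, e2⟩ := dm_rg_mul (h := x) (c := c) (by rw [hc1, hx])
      have hxcn : dm (x * c) ≠ rg (x * c) := by rw [e1, e2]; exact hc2.symm
      obtain ⟨d, hd⟩ := R_exists L hS hcn
      obtain ⟨k, hk⟩ := R_exists L hS hxcn
      have := (hk.munn hTC hS hT hxcn).mul
        (hd.inv.munn hTC hS hT (by rw [dm_inv, rg_inv]; exact hcn.symm))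
      have hb : x * c * c⁻¹ = x := by
        rw [mul_assoc]; show x * dm c = x
        rw [hc1, hx, mul_rg_self]
      rw [hb] at this
      exact ⟨_, this⟩
  · obtain ⟨y, hy⟩ := R_exists L hS hx
    exact ⟨y, hy.munn hTC hS hT hx⟩

theorem _root_.IS.hom_inv {φ : S → T} (h : ∀ a b, φ (a * b) = φ a * φ b) (a : S) :
    φ a⁻¹ = (φ a)⁻¹ := by
  apply InverseSemigroup.inv_unique
  · rw [← h, ← h, mul_assoc, mim]
  · rw [← h, ← h, mul_assoc, imi]

theorem main (L : LI S T) (hTC : TightlyConnected S) (hF : Fundamental S) (hS : CSS S)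
    (hNI : NoIsolatedNontrivial S) :
    ∃! φ : S → T, Function.Bijective φ ∧ (∀ a b : S, φ (a * b) = φ a * φ b) ∧
      ∀ (U : Set S), IsInvSub U → L.F U = φ '' U := by
  have hT := L.css_transfer hS
  have hTF := L.T_fund hTC hF hS hT hNI
  have huniq : ∀ x t t', L.M x t → L.M x t' → t = t' := by
    intro x t t' h h'
    apply hTF
    intro g hg
    have h1 := h _ (L.q_idem hg)
    have h2 := h' _ (L.q_idem hg)
    rw [L.pq hg] at h1 h2
    rw [← h1, h2]
  choose φ hφ using L.M_exists hTC hS hT hNI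
  have hmul : ∀ a b, φ (a * b) = φ a * φ b :=
    fun a b => huniq _ _ _ (hφ (a * b)) ((hφ a).mul (hφ b))
  have hφe : ∀ e, IsIdempotentElem e → φ e = L.p e :=
    fun e he => huniq _ _ _ (hφ e) (M_idem he)
  have hφR : ∀ x y, dm x ≠ rg x → L.R x y → φ x = y :=
    fun x y hx h => huniq _ _ _ (hφ x) (h.munn hTC hS hT hx)
  have hφR' : ∀ x, dm x ≠ rg x → L.R x (φ x) := by
    intro x hx
    obtain ⟨y, hy⟩ := R_exists L hS hx
    rw [hφR x y hx hy]; exact hy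
  have hsurjN : ∀ t, dm t ≠ rg t → ∃ x, φ x = t := by
    intro t ht
    obtain ⟨x, hx⟩ := R_exists L.symm hT ht
    exact ⟨x, hφR x t (hx.ne ht) hx.symm⟩
  have hdm : ∀ x, dm (φ x) = L.p (dm x) := by
    intro x
    rw [dm, ← hom_inv hmul, ← hmul]; exact hφe _ (dm_idem x)
  have hrg : ∀ x, rg (φ x) = L.p (rg x) := by
    intro x
    rw [rg, ← hom_inv hmul, ← hmul]; exact hφe _ (rg_idem x)
  have hinj : Function.Injective φ := by
    intro a b hab
    have h1 := hφ a
    rw [hab] at h1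
    exact h1.inj hF (hφ b)
  have hsurj : Function.Surjective φ := by
    intro t
    by_cases ht : dm t = rg t
    · have hqi := L.q_idem (dm_idem t)
      have hpq := L.pq (dm_idem t)
      rcases nontriv hNI hqi with h1 | ⟨c, hc1, hc2⟩
      · have := L.trivial_transfer hqi h1 (t := t) hpq.symm (by rw [hpq, ht])
        exact ⟨_, by rw [hφe _ hqi, ← this]⟩
      · have hcn : dm c ≠ rg c := by rw [hc1]; exact hc2.symm
        have hdd : dm (φ c) = dm t := by rw [hdm, hc1, hpq]
        have hdn := (hφR' c hcn).ne hcn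
        obtain ⟨e1, e2⟩ := dm_rg_mul (h := t) (c := φ c) (by rw [hdd, ht])
        obtain ⟨x, hx⟩ := hsurjN (t * φ c) (by rw [e1, e2, ← hdd]; exact hdn)
        refine ⟨x * c⁻¹, ?_⟩
        rw [hmul, hx, hom_inv hmul, mul_assoc]
        show t * dm (φ c) = t
        rw [hdd, ht, mul_rg_self]
    · exact hsurjN t ht
  have hmem : ∀ (U : Set S), IsInvSub U → ∀ x, x ∈ U ↔ φ x ∈ L.F U := by
    intro U hU x
    by_cases hx : dm x = rg x
    · rcases nontriv hNI (dm_idem x) with h1 | ⟨c, hc1, hc2⟩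
      · have h2 := h1 x rfl hx.symm
        rw [h2, hφe _ (dm_idem x)]
        exact L.mem_idem (dm_idem x) hU
      · have hcn : dm c ≠ rg c := by rw [hc1]; exact hc2.symm
        obtain ⟨e1, e2⟩ := dm_rg_mul (h := x) (c := c) (by rw [hc1, hx])
        have hxcn : dm (x * c) ≠ rg (x * c) := by rw [e1, e2]; exact hc2.symm
        have r1 := hφR' c hcn
        have r2 := hφR' _ hxcn
        rw [hmul] at r2
        have p1 := hdm x
        have p2 : rg (φ x) = L.p (dm x) := by rw [hrg, hx]
        have hq : L.symm.p (L.p (dm x)) = dm x := L.qp (dm_idem x)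
        constructor
        · intro h
          exact L.group_mem hT (dm_idem x) rfl hx.symm p1 p2 hc1 hcn r1 r2 hU h
        · intro h
          have := L.symm.group_mem hS (L.p_idem (dm_idem x)) p1 p2 (k := x) (d := c) (c := φ c)
            hq.symm (by rw [hq, hx]) (by rw [hdm, hc1]) (r1.ne hcn) r1.symm r2.symm
            (L.F_sub hU) h
          change x ∈ L.G (L.F U) at this
          rwa [L.GF hU] at this
    · exact (hφR' x hx).mem hU
  refine ⟨φ, ⟨⟨hinj, hsurj⟩, hmul, ?_⟩, ?_⟩
  · intro U hU
    ext t
    constructor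
    · intro ht
      obtain ⟨x, rfl⟩ := hsurj t
      exact ⟨x, (hmem U hU x).2 ht, rfl⟩
    · rintro ⟨x, hx, rfl⟩
      exact (hmem U hU x).1 hx
  · rintro φ' ⟨_, hmul', himg⟩
    funext x
    apply huniq x _ _ _ (hφ x)
    have hE : ∀ e, IsIdempotentElem e → L.p e = φ' e := by
      intro e he
      have := himg {e} (sing_sub he)
      rw [L.F_sing he, Set.image_singleton] at this
      exact Set.singleton_injective this
    intro e he
    rw [hE _ (conj_idem he x), hE e he, hmul', hmul', hom_inv hmul']

end LI

end IS


/-- if `S` is a tightly connected, fundamental, completely semisimple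
inverse semigroup with no isolated nontrivial subgroups,
`T` an inverse semigroup, and `Ψ` a lattice isomorphism of `S` onto `T` whose
associated `E`-bijection is a semilattice isomorphism of `E_S` onto `E_T`, then
there is a unique isomorphism of `S` onto `T` inducing `Ψ`. -/
theorem stmt8 {S T : Type*} [InverseSemigroup S] [InverseSemigroup T]
    (hTC : TightlyConnected S) (hF : Fundamental S) (hCS : CompletelySemisimple S)
    (hNI : NoIsolatedNontrivial S)
    -- `Ψ` is a lattice isomorphism of `S` onto `T`:
    (Ψ : {U : Set S // IsInvSub U} → {V : Set T // IsInvSub V})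
    (hΨbij : Function.Bijective Ψ)
    (hΨord : ∀ U V : {U : Set S // IsInvSub U}, U.1 ⊆ V.1 ↔ (Ψ U).1 ⊆ (Ψ V).1)
    -- `ψE` is the associated `E`-bijection:
    (ψE : S → T)
    (hΨE : ∀ e : S, IsIdempotentElem e → ∀ h : IsInvSub ({e} : Set S),
      (Ψ ⟨{e}, h⟩).1 = {ψE e})
    -- `ψE` is a semilattice isomorphism of `E_S` onto `E_T`:
    (hE1 : ∀ e : S, IsIdempotentElem e → IsIdempotentElem (ψE e))
    (hE2 : ∀ e f : S, IsIdempotentElem e → IsIdempotentElem f → ψE e = ψE f → e = f)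
    (hE3 : ∀ f : T, IsIdempotentElem f → ∃ e : S, IsIdempotentElem e ∧ ψE e = f)
    (hE4 : ∀ e f : S, IsIdempotentElem e → IsIdempotentElem f →
      ψE (e * f) = ψE e * ψE f) :
    ∃! φ : S → T, Function.Bijective φ ∧ (∀ a b : S, φ (a * b) = φ a * φ b) ∧
      ∀ (U : Set S) (h : IsInvSub U), (Ψ ⟨U, h⟩).1 = φ '' U := by
  classical
  obtain ⟨Φ, hΦ1, hΦ2⟩ := Function.bijective_iff_has_inverse.1 hΨbij
  have hE4 : ∀ g : T, ∃ e : S, IsIdempotentElem g → (IsIdempotentElem e ∧ ψE e = g) := by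
    intro g
    by_cases hg : IsIdempotentElem g
    · obtain ⟨e, h⟩ := hE3 g hg
      exact ⟨e, fun _ => h⟩
    · obtain ⟨e, _⟩ := hE3 _ (IS.dm_idem g)
      exact ⟨e, fun h => absurd h hg⟩
  choose r hr using hE4
  have hr1 := fun g hg => (hr g hg).1
  have hr2 := fun g hg => (hr g hg).2
  let L : IS.LI S T :=
    { F := fun U => if h : IsInvSub U then (Ψ ⟨U, h⟩).1 else ∅
      G := fun V => if h : IsInvSub V then (Φ ⟨V, h⟩).1 else ∅
      p := ψE
      q := r
      F_sub := by
        intro U h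
        simp only [dif_pos h]
        exact (Ψ ⟨U, h⟩).2
      G_sub := by
        intro V h
        simp only [dif_pos h]
        exact (Φ ⟨V, h⟩).2
      GF := by
        intro U h
        simp only [dif_pos h]
        rw [dif_pos (Ψ ⟨U, h⟩).2]
        exact congrArg Subtype.val (hΦ1 ⟨U, h⟩)
      FG := by
        intro V h
        simp only [dif_pos h]
        rw [dif_pos (Φ ⟨V, h⟩).2]
        exact congrArg Subtype.val (hΦ2 ⟨V, h⟩)
      F_mono := by
        intro U V hU hV h
        simp only [dif_pos hU, dif_pos hV]
        exact (hΨord ⟨U, hU⟩ ⟨V, hV⟩).1 h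
      G_mono := by
        intro U V hU hV h
        simp only [dif_pos hU, dif_pos hV]
        rw [hΨord, hΦ2, hΦ2]
        exact h
      p_idem := fun {e} he => hE1 e he
      q_idem := fun {e} he => hr1 e he
      qp := fun {e} he => hE2 _ _ (hr1 _ (hE1 e he)) he (hr2 _ (hE1 e he))
      pq := fun {e} he => hr2 e he
      F_sing := by
        intro e he
        simp only [dif_pos (IS.sing_sub he)]
        exact hΨE e he _
      G_sing := by
        intro g hg
        simp only [dif_pos (IS.sing_sub hg)]
        have h1 := hΨE (r g) (hr1 g hg) (IS.sing_sub (hr1 g hg))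
        rw [hr2 g hg] at h1
        have h2 : Ψ ⟨{r g}, IS.sing_sub (hr1 g hg)⟩ = ⟨{g}, IS.sing_sub hg⟩ := Subtype.ext h1
        rw [← h2, hΦ1]
      p_mul := fun {e f} he hf => hE4 e f he hf
      q_mul := by
        intro g k hg hk
        apply hE2 _ _ (hr1 _ (IS.idem_mul hg hk)) (IS.idem_mul (hr1 g hg) (hr1 k hk))
        rw [hr2 _ (IS.idem_mul hg hk), hE4 _ _ (hr1 g hg) (hr1 k hk), hr2 g hg, hr2 k hk] }
  have hL : ∀ (U : Set S) (h : IsInvSub U), L.F U = (Ψ ⟨U, h⟩).1 := fun U h => dif_pos h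
  obtain ⟨φ, ⟨h1, h2, h3⟩, h4⟩ := L.main hTC hF (IS.css_of hCS) hNI
  refine ⟨φ, ⟨h1, h2, fun U h => ?_⟩, ?_⟩
  · rw [← hL U h]; exact h3 U h
  · rintro φ' ⟨a1, a2, a3⟩
    exact h4 φ' ⟨a1, a2, fun U h => by rw [hL U h]; exact a3 U h⟩
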